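/- arXiv:2003.02618 — 2 statements merged into one kernel-verified Lean document; each statement's English description precedes it below -/
import Mathlib

section
/- Let h be a smooth solution of the Hele-Shaw equation on [0,T] and let Φ : ℝ → [0,∞) be a C² convex function. Then the function I_Φ(t) = ∫_{𝕋ⁿ} Φ(h(t,x)) dx is non-increasing on [0,T], i.e. (d/dt) I_Φ(t) ≤ 0 for all t ∈ [0,T]. -/
open MeasureTheory
open scoped Classical

noncomputable section

/-- ℤⁿ-periodicity for functions on ℝⁿ (model for functions on the torus 𝕋ⁿ = ℝⁿ/ℤⁿ). -/
def ZPeriodic (n : ℕ) (f : (Fin n → ℝ) → ℝ) : Prop :=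
  ∀ (x : Fin n → ℝ) (k : Fin n → ℤ), f (x + fun i => (k i : ℝ)) = f x

/-- ℤⁿ-periodicity in the horizontal variable for functions on ℝⁿ × ℝ. -/
def ZPeriodicE (n : ℕ) (φ : (Fin n → ℝ) × ℝ → ℝ) : Prop :=
  ∀ (x : Fin n → ℝ) (y : ℝ) (k : Fin n → ℤ), φ (x + fun i => (k i : ℝ), y) = φ (x, y)

/-- Fundamental cell of the torus 𝕋ⁿ. -/
def cell (n : ℕ) : Set (Fin n → ℝ) := Set.univ.pi fun _ => Set.Ico (0:ℝ) 1

/-- i-th partial derivative of a function on ℝⁿ. -/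
def pdX (n : ℕ) (f : (Fin n → ℝ) → ℝ) (i : Fin n) (x : Fin n → ℝ) : ℝ :=
  fderiv ℝ f x (Pi.single i 1)

/-- Directional derivative of a function on ℝⁿ × ℝ. -/
def pdE (n : ℕ) (φ : (Fin n → ℝ) × ℝ → ℝ) (v : (Fin n → ℝ) × ℝ)
    (p : (Fin n → ℝ) × ℝ) : ℝ := fderiv ℝ φ p v

def eX (n : ℕ) (i : Fin n) : (Fin n → ℝ) × ℝ := (Pi.single i 1, 0)
def eY (n : ℕ) : (Fin n → ℝ) × ℝ := (0, 1)

/-- Laplacian Δ_{x,y} on ℝⁿ × ℝ. -/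
def lapE (n : ℕ) (φ : (Fin n → ℝ) × ℝ → ℝ) (p : (Fin n → ℝ) × ℝ) : ℝ :=
  (∑ i, pdE n (pdE n φ (eX n i)) (eX n i) p) + pdE n (pdE n φ (eY n)) (eY n) p

/-- |∇_{x,y}φ|². -/
def gradSqE (n : ℕ) (φ : (Fin n → ℝ) × ℝ → ℝ) (p : (Fin n → ℝ) × ℝ) : ℝ :=
  (∑ i, (pdE n φ (eX n i) p)^2) + (pdE n φ (eY n) p)^2

/-- One periodic cell of the fluid domain Ω(h) = {y < h(x)}. -/
def fluidCell (n : ℕ) (h : (Fin n → ℝ) → ℝ) : Set ((Fin n → ℝ) × ℝ) :=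
  {p | p.1 ∈ cell n ∧ p.2 < h p.1}

/-- φ is the harmonic extension of ψ to Ω(h) = {y < h(x)}: it is harmonic in Ω(h),
has boundary value ψ, is periodic in x, and has square-integrable gradient. -/
structure IsHarmonicExt (n : ℕ) (h ψ : (Fin n → ℝ) → ℝ)
    (φ : (Fin n → ℝ) × ℝ → ℝ) : Prop where
  smooth : ContDiff ℝ (⊤ : ℕ∞) φ
  periodic : ZPeriodicE n φ
  harmonic : ∀ p : (Fin n → ℝ) × ℝ, p.2 < h p.1 → lapE n φ p = 0
  boundary : ∀ x, φ (x, h x) = ψ x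
  gradL2 : IntegrableOn (gradSqE n φ) (fluidCell n h)

/-- The Dirichlet-to-Neumann operator:
(G(h)ψ)(x) = ∂_yφ(x,h(x)) − ∇h(x)·∇_xφ(x,h(x)), where φ is the harmonic extension of ψ. -/
def DtN (n : ℕ) (h ψ : (Fin n → ℝ) → ℝ) : (Fin n → ℝ) → ℝ :=
  if H : ∃ φ, IsHarmonicExt n h ψ φ then
    fun x => pdE n H.choose (eY n) (x, h x)
      - ∑ i, pdX n h i x * pdE n H.choose (eX n i) (x, h x)
  else 0

/-- (B(h)ψ)(x) = ∂_yφ(x,h(x)). -/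
def Bop (n : ℕ) (h ψ : (Fin n → ℝ) → ℝ) : (Fin n → ℝ) → ℝ :=
  if H : ∃ φ, IsHarmonicExt n h ψ φ then
    fun x => pdE n H.choose (eY n) (x, h x)
  else 0

/-- (V(h)ψ)(x) = ∇_xφ(x,h(x)). -/
def Vop (n : ℕ) (h ψ : (Fin n → ℝ) → ℝ) : (Fin n → ℝ) → Fin n → ℝ :=
  if H : ∃ φ, IsHarmonicExt n h ψ φ then
    fun x i => pdE n H.choose (eX n i) (x, h x)
  else 0

/-- Divergence of a vector field on the torus. -/
def divX (n : ℕ) (W : (Fin n → ℝ) → Fin n → ℝ) (x : Fin n → ℝ) : ℝ :=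
  ∑ i, pdX n (fun z => W z i) i x

/-- h is a smooth solution of the Hele-Shaw equation ∂ₜh + G(h)h = 0 on [0,T]. -/
structure IsHeleShawSol (n : ℕ) (T : ℝ) (h : ℝ → (Fin n → ℝ) → ℝ) : Prop where
  smooth : ContDiff ℝ (⊤ : ℕ∞) (Function.uncurry h)
  periodic : ∀ t : ℝ, ZPeriodic n (h t)
  extension : ∀ t ∈ Set.Icc 0 T, ∃ φ, IsHarmonicExt n (h t) (h t) φ
  equation : ∀ t ∈ Set.Icc 0 T, ∀ x, deriv (fun s => h s x) t + DtN n (h t) (h t) x = 0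

/-- B(t,x) = (B(h(t,·))h(t,·))(x). -/
def HSB (n : ℕ) (h : ℝ → (Fin n → ℝ) → ℝ) (t : ℝ) (x : Fin n → ℝ) : ℝ :=
  Bop n (h t) (h t) x

/-- V(t,x) = (V(h(t,·))h(t,·))(x). -/
def HSV (n : ℕ) (h : ℝ → (Fin n → ℝ) → ℝ) (t : ℝ) (x : Fin n → ℝ) : Fin n → ℝ :=
  Vop n (h t) (h t) x

/-- The Rayleigh–Taylor coefficient a = 1 − B. -/
def HSa (n : ℕ) (h : ℝ → (Fin n → ℝ) → ℝ) (t : ℝ) (x : Fin n → ℝ) : ℝ :=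
  1 - HSB n h t x

/-- γ = (1+|∇h|²)⁻¹ ( G(h)(B²+|V|²) − 2B G(h)B − 2V·G(h)V ). -/
def HSgamma (n : ℕ) (h : ℝ → (Fin n → ℝ) → ℝ) (t : ℝ) (x : Fin n → ℝ) : ℝ :=
  (1 + ∑ i, (pdX n (h t) i x)^2)⁻¹ *
    ( DtN n (h t) (fun z => (HSB n h t z)^2 + ∑ i, (HSV n h t z i)^2) x
      - 2 * HSB n h t x * DtN n (h t) (fun z => HSB n h t z) x
      - 2 * ∑ i, HSV n h t x i * DtN n (h t) (fun z => HSV n h t z i) x )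

/-- L(h)f = −V·∇f − ½(div V)f + √a G(h)(√a f). -/
def Lop (n : ℕ) (h : ℝ → (Fin n → ℝ) → ℝ) (t : ℝ) (f : (Fin n → ℝ) → ℝ)
    (x : Fin n → ℝ) : ℝ :=
  - (∑ i, HSV n h t x i * pdX n f i x)
  - (1/2) * divX n (HSV n h t) x * f x
  + Real.sqrt (HSa n h t x) * DtN n (h t) (fun z => Real.sqrt (HSa n h t z) * f z) x


lemma hs_cell_ae (n : ℕ) : cell n =ᵐ[volume] Set.Icc (0 : Fin n → ℝ) 1 := by
  have := Measure.univ_pi_Ico_ae_eq_Icc (μ := fun _ : Fin n => (volume : Measure ℝ))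
    (f := 0) (g := 1)
  rw [← volume_pi] at this
  exact this

lemma hs_cell_subset (n : ℕ) : cell n ⊆ Set.Icc (0 : Fin n → ℝ) 1 := by
  intro x hx
  simp only [cell, Set.mem_univ_pi, Set.mem_Ico] at hx
  exact ⟨fun i => (hx i).1, fun i => (hx i).2.le⟩

lemma hs_cell_meas (n : ℕ) : MeasurableSet (cell n) :=
  MeasurableSet.univ_pi fun _ => measurableSet_Ico

lemma hs_cell_vol (n : ℕ) : (volume : Measure (Fin n → ℝ)) (cell n) = 1 := by
  rw [cell, Real.volume_pi_Ico]
  simp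

lemma hs_cont_int (n : ℕ) {f : (Fin n → ℝ) → ℝ} (hf : Continuous f) :
    IntegrableOn f (cell n) :=
  (hf.continuousOn.integrableOn_compact isCompact_Icc).mono_set (hs_cell_subset n)

lemma hs_param (n : ℕ) (u u' : ℝ → (Fin n → ℝ) → ℝ)
    (hu : Continuous (Function.uncurry u)) (hu' : Continuous (Function.uncurry u'))
    (hd : ∀ s x, HasDerivAt (fun r => u r x) (u' s x) s) (s : ℝ) :
    HasDerivAt (fun r => ∫ x in cell n, u r x) (∫ x in cell n, u' s x) s := by
  have hus : ∀ r, Continuous (u r) := fun r => hu.comp (by fun_prop : Continuous fun x => (r, x))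
  have hus' : ∀ r, Continuous (u' r) :=
    fun r => hu'.comp (by fun_prop : Continuous fun x => (r, x))
  obtain ⟨C, hC⟩ := ((isCompact_Icc (a := s - 1) (b := s + 1)).prod
    (isCompact_Icc (a := (0 : Fin n → ℝ)) (b := 1))).exists_bound_of_continuousOn hu'.continuousOn
  refine (hasDerivAt_integral_of_dominated_loc_of_deriv_le (F := u) (F' := u')
    (bound := fun _ => C) (μ := volume.restrict (cell n)) (s := Set.Icc (s - 1) (s + 1))
    (Icc_mem_nhds (by linarith) (by linarith)) ?_ (hs_cont_int n (hus s)) ?_ ?_ ?_ ?_).2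
  · exact Filter.Eventually.of_forall fun r => (hus r).aestronglyMeasurable
  · exact (hus' s).aestronglyMeasurable
  · filter_upwards [ae_restrict_mem (hs_cell_meas n)] with x hx r hr
    exact hC (r, x) ⟨hr, hs_cell_subset n hx⟩
  · exact hs_cont_int n continuous_const
  · exact Filter.Eventually.of_forall fun x r _ => hd r x

lemma hs_div (n : ℕ) (hn : 1 ≤ n) (W : Fin n → (Fin n → ℝ) → ℝ)
    (hW : ∀ i, ContDiff ℝ 1 (W i)) (hp : ∀ i, ZPeriodic n (W i)) :
    ∫ x in cell n, ∑ i, pdX n (W i) i x = 0 := by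
  obtain ⟨m, rfl⟩ : ∃ m, n = m + 1 := ⟨n - 1, by omega⟩
  rw [setIntegral_congr_set (hs_cell_ae (m + 1))]
  have hc : ∀ i, Continuous fun x => pdX (m + 1) (W i) i x := fun i =>
    ((hW i).continuous_fderiv (by simp)).clm_apply continuous_const
  have := integral_divergence_of_hasFDerivAt_off_countable' (0 : Fin (m + 1) → ℝ) 1
    zero_le_one W (fun i x => fderiv ℝ (W i) x) ∅ Set.countable_empty
    (fun i => (hW i).continuous.continuousOn)
    (fun x _ i => ((hW i).differentiable (by simp) x).hasFDerivAt)
    ((continuous_finsetSum _ fun i _ => hc i).continuousOn.integrableOn_compact isCompact_Icc)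
  refine this.trans (Finset.sum_eq_zero fun i _ => ?_)
  rw [sub_eq_zero]
  congr 1
  ext x
  rw [← hp i (i.insertNth ((0 : Fin (m + 1) → ℝ) i) x) (Pi.single i 1)]
  congr 1
  ext j
  rcases Fin.eq_self_or_eq_succAbove i j with rfl | ⟨k, rfl⟩ <;> simp

/-- convexity: nonneg second derivative, and truncated derivative -/
lemma hs_trunc (Φ : ℝ → ℝ) (hΦC2 : ContDiff ℝ 2 Φ) (hΦconv : ConvexOn ℝ Set.univ Φ) (R : ℝ)
    (hR : 0 ≤ R) :
    ∃ g : ℝ → ℝ, ContDiff ℝ 1 g ∧ (∀ s, 0 ≤ deriv g s) ∧ (∃ C, ∀ s, |g s| ≤ C) ∧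
      ∀ s, |s| ≤ R → g s = deriv Φ s := by
  have h1 : ContDiff ℝ 1 (deriv Φ) := by
    have : ContDiff ℝ (1 + 1) Φ := by simpa [one_add_one_eq_two] using hΦC2
    exact (contDiff_succ_iff_deriv.1 this).2.2
  have hd : Differentiable ℝ Φ := hΦC2.differentiable (by simp)
  have hmono : Monotone (deriv Φ) := by
    have := hΦconv.monotoneOn_deriv (fun x _ => hd x)
    exact monotoneOn_univ.1 this
  have hc2 : Continuous (deriv (deriv Φ)) := h1.continuous_deriv le_rfl
  set χ : ℝ → ℝ := fun u => max 0 (min 1 (R + 1 - |u|)) with hχ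
  have hχc : Continuous χ := by fun_prop
  set k : ℝ → ℝ := fun u => deriv (deriv Φ) u * χ u with hk
  have hkc : Continuous k := hc2.mul hχc
  have hsupp : HasCompactSupport k := by
    refine HasCompactSupport.intro (isCompact_Icc (a := -(R + 1)) (b := R + 1)) fun x hx => ?_
    have : R + 1 < |x| := by
      by_contra hcon
      exact hx (abs_le.1 (not_lt.1 hcon))
    have : χ x = 0 := by
      simp only [hχ]
      exact max_eq_left ((min_le_right _ _).trans (by linarith))
    simp [hk, this]
  have hki : Integrable k := hkc.integrable_of_hasCompactSupport hsupp
  have hgd : ∀ s, HasDerivAt (fun s => deriv Φ 0 + ∫ u in (0:ℝ)..s, k u) (k s) s := fun s =>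
    (intervalIntegral.integral_hasDerivAt_right (hkc.intervalIntegrable _ _)
      (hkc.stronglyMeasurableAtFilter _ _) hkc.continuousAt).const_add _
  have hgd' : deriv (fun s => deriv Φ 0 + ∫ u in (0:ℝ)..s, k u) = k := funext fun s => (hgd s).deriv
  refine ⟨fun s => deriv Φ 0 + ∫ u in (0:ℝ)..s, k u, ?_, ?_, ⟨|deriv Φ 0| + ∫ u, ‖k u‖, ?_⟩, ?_⟩
  · rw [contDiff_one_iff_deriv, hgd']
    exact ⟨fun s => (hgd s).differentiableAt, hkc⟩
  · intro s
    rw [hgd']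
    exact mul_nonneg (hmono.deriv_nonneg) (le_max_left _ _)
  · intro s
    refine (abs_add_le _ _).trans (add_le_add le_rfl ?_)
    rw [← Real.norm_eq_abs]
    refine (intervalIntegral.norm_integral_le_integral_norm_uIoc).trans ?_
    exact setIntegral_le_integral hki.norm (Filter.Eventually.of_forall fun _ => norm_nonneg _)
  · intro s hs
    have : ∫ u in (0:ℝ)..s, k u = ∫ u in (0:ℝ)..s, deriv (deriv Φ) u := by
      refine intervalIntegral.integral_congr fun u hu => ?_
      have hu' : |u| ≤ R := by
        have : |u - 0| ≤ |s - 0| := Set.abs_sub_left_of_mem_uIcc hu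
        simp at this
        linarith
      have : χ u = 1 := by
        simp only [hχ]
        rw [min_eq_left (by linarith), max_eq_right zero_le_one]
      simp [hk, this]
    simp only [this]
    rw [intervalIntegral.integral_deriv_eq_sub (fun x _ => h1.differentiable (by simp) x)
      (hc2.intervalIntegrable _ _)]
    ring
lemma hs_pdE_smooth (n : ℕ) {φ : (Fin n → ℝ) × ℝ → ℝ} (hφ : ContDiff ℝ (⊤ : ℕ∞) φ)
    (v : (Fin n → ℝ) × ℝ) : ContDiff ℝ (⊤ : ℕ∞) (pdE n φ v) :=
  (hφ.fderiv_right (m := (⊤ : ℕ∞)) (by simp)).clm_apply contDiff_const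

lemma hs_pdX_smooth (n : ℕ) {h : (Fin n → ℝ) → ℝ} (hh : ContDiff ℝ (⊤ : ℕ∞) h)
    (i : Fin n) : ContDiff ℝ (⊤ : ℕ∞) (pdX n h i) :=
  (hh.fderiv_right (m := (⊤ : ℕ∞)) (by simp)).clm_apply contDiff_const

lemma hs_deriv_s (n : ℕ) {f : (Fin n → ℝ) × ℝ → ℝ} (hf : Differentiable ℝ f)
    (x : Fin n → ℝ) (c s : ℝ) :
    HasDerivAt (fun r => f (x, c + r)) (pdE n f (eY n) (x, c + s)) s := by
  have h1 : HasDerivAt (fun r : ℝ => ((x, c + r) : (Fin n → ℝ) × ℝ)) (0, 1) s :=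
    (hasDerivAt_const s x).prodMk ((hasDerivAt_id s).const_add c)
  exact (hf (x, c + s)).hasFDerivAt.comp_hasDerivAt s h1

lemma hs_deriv_x (n : ℕ) {f : (Fin n → ℝ) × ℝ → ℝ} (hf : Differentiable ℝ f)
    {h : (Fin n → ℝ) → ℝ} (hh : Differentiable ℝ h) (x : Fin n → ℝ) (s : ℝ) (i : Fin n) :
    pdX n (fun x => f (x, h x + s)) i x =
      pdE n f (eX n i) (x, h x + s) + pdX n h i x * pdE n f (eY n) (x, h x + s) := by
  have h1 : HasFDerivAt (fun z : Fin n → ℝ => ((z, h z + s) : (Fin n → ℝ) × ℝ))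
      ((ContinuousLinearMap.id ℝ _).prod (fderiv ℝ h x)) x :=
    (hasFDerivAt_id x).prodMk ((hh x).hasFDerivAt.add_const s)
  have h2 := (hf (x, h x + s)).hasFDerivAt.comp x h1
  unfold pdX pdE
  have h3 : fderiv ℝ (fun x => f (x, h x + s)) x = _ := h2.fderiv
  rw [h3]
  have : ((Pi.single i 1, fderiv ℝ h x (Pi.single i 1)) : (Fin n → ℝ) × ℝ) =
      eX n i + fderiv ℝ h x (Pi.single i 1) • eY n := by
    ext <;> simp [eX, eY]
  simp [this]

lemma hs_pdX_mul (n : ℕ) {f g : (Fin n → ℝ) → ℝ} {x : Fin n → ℝ} (hf : DifferentiableAt ℝ f x)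
    (hg : DifferentiableAt ℝ g x) (i : Fin n) :
    pdX n (fun x => f x * g x) i x = f x * pdX n g i x + pdX n f i x * g x := by
  unfold pdX
  rw [fderiv_fun_mul hf hg]
  simp
  ring

lemma hs_pdE_comp (n : ℕ) {g : ℝ → ℝ} {φ : (Fin n → ℝ) × ℝ → ℝ} {p : (Fin n → ℝ) × ℝ}
    (hg : DifferentiableAt ℝ g (φ p)) (hφ : DifferentiableAt ℝ φ p) (v : (Fin n → ℝ) × ℝ) :
    pdE n (fun q => g (φ q)) v p = deriv g (φ p) * pdE n φ v p := by
  unfold pdE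
  have : fderiv ℝ (fun q => g (φ q)) p = _ := (hg.hasDerivAt.comp_hasFDerivAt p hφ.hasFDerivAt).fderiv
  rw [this]
  simp

lemma hs_pdE_periodic (n : ℕ) {φ : (Fin n → ℝ) × ℝ → ℝ} (hp : ZPeriodicE n φ)
    (v : (Fin n → ℝ) × ℝ) : ZPeriodicE n (pdE n φ v) := by
  intro x y k
  unfold pdE
  have h1 : (fun p : (Fin n → ℝ) × ℝ => φ (p + ((fun i => (k i : ℝ)), 0))) = φ := by
    ext ⟨a, b⟩
    simpa using hp a b k
  have h2 := fderiv_comp_add_right (𝕜 := ℝ) (f := φ) (x := (x, y)) ((fun i => (k i : ℝ)), (0:ℝ))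
  rw [h1] at h2
  rw [h2]
  simp

/-- The weighted flux through the surface `y = h(x) + s`. -/
lemma hs_flux_mono (n : ℕ) (hn : 1 ≤ n) (h φ) (hh : ContDiff ℝ (⊤ : ℕ∞) h) (hp : ZPeriodic n h)
    (H : IsHarmonicExt n h h φ) (g : ℝ → ℝ) (hg : ContDiff ℝ 1 g) (hg' : ∀ s, 0 ≤ deriv g s) :
    MonotoneOn (fun s => ∫ x in cell n, g (φ (x, h x + s)) * (pdE n φ (eY n) (x, h x + s)
      - ∑ i, pdX n h i x * pdE n φ (eX n i) (x, h x + s))) (Set.Iic 0) := by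
  have hφ := H.smooth
  have hφd : Differentiable ℝ φ := hφ.differentiable (by simp)
  have hhd : Differentiable ℝ h := hh.differentiable (by simp)
  have hgd : Differentiable ℝ g := hg.differentiable (by simp)
  have hD : ∀ v, Differentiable ℝ (pdE n φ v) := fun v =>
    (hs_pdE_smooth n hφ v).differentiable (by simp)
  have hcφ := hφ.continuous
  have hch := hh.continuous
  have hcg := hg.continuous
  have hcg' : Continuous (deriv g) := hg.continuous_deriv le_rfl
  have hcD : ∀ v, Continuous (pdE n φ v) := fun v => (hs_pdE_smooth n hφ v).continuous
  have hcDD : ∀ v w, Continuous (pdE n (pdE n φ v) w) := fun v w =>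
    (hs_pdE_smooth n (hs_pdE_smooth n hφ v) w).continuous
  have hcX : ∀ i, Continuous (pdX n h i) := fun i => (hs_pdX_smooth n hh i).continuous
  set u' : ℝ → (Fin n → ℝ) → ℝ := fun s x =>
    (deriv g (φ (x, h x + s)) * pdE n φ (eY n) (x, h x + s)) * (pdE n φ (eY n) (x, h x + s)
      - ∑ i, pdX n h i x * pdE n φ (eX n i) (x, h x + s)) +
    g (φ (x, h x + s)) * (pdE n (pdE n φ (eY n)) (eY n) (x, h x + s)
      - ∑ i, pdX n h i x * pdE n (pdE n φ (eX n i)) (eY n) (x, h x + s)) with hu'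
  have hder : ∀ s, HasDerivAt (fun s => ∫ x in cell n, g (φ (x, h x + s)) *
      (pdE n φ (eY n) (x, h x + s) - ∑ i, pdX n h i x * pdE n φ (eX n i) (x, h x + s)))
      (∫ x in cell n, u' s x) s := by
    refine hs_param n (fun s x => g (φ (x, h x + s)) *
      (pdE n φ (eY n) (x, h x + s) - ∑ i, pdX n h i x * pdE n φ (eX n i) (x, h x + s))) u'
      ?_ ?_ ?_
    · simp only [Function.uncurry_def]; fun_prop
    · simp only [hu', Function.uncurry_def]; fun_prop
    · intro s x
      have e1 := (hgd (φ (x, h x + s))).hasDerivAt.comp s (hs_deriv_s n hφd x (h x) s)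
      have e2 := (hs_deriv_s n (hD (eY n)) x (h x) s).sub (HasDerivAt.fun_sum (u := Finset.univ)
        fun i _ => (hs_deriv_s n (hD (eX n i)) x (h x) s).const_mul (pdX n h i x))
      exact e1.mul e2
  refine monotoneOn_of_deriv_nonneg (convex_Iic 0) ?_ ?_ ?_
  · exact fun s _ => (hder s).continuousAt.continuousWithinAt
  · exact fun s _ => (hder s).differentiableAt.differentiableWithinAt
  · intro s hs
    rw [interior_Iic] at hs
    rw [(hder s).deriv]
    -- horizontal field
    set W : Fin n → (Fin n → ℝ) → ℝ := fun i x =>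
      g (φ (x, h x + s)) * pdE n φ (eX n i) (x, h x + s) with hW
    have hφ1 : ContDiff ℝ 1 φ := hφ.of_le (by exact_mod_cast le_top)
    have hh1 : ContDiff ℝ 1 h := hh.of_le (by exact_mod_cast le_top)
    have hD1 : ∀ v, ContDiff ℝ 1 (pdE n φ v) := fun v =>
      (hs_pdE_smooth n hφ v).of_le (by exact_mod_cast le_top)
    have hW1 : ∀ i, ContDiff ℝ 1 (W i) := fun i => by
      simp only [hW]
      have := hD1 (eX n i)
      fun_prop
    have hWp : ∀ i, ZPeriodic n (W i) := fun i x k => by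
      simp only [hW, hp x k, H.periodic x _ k, hs_pdE_periodic n H.periodic _ x _ k]
    have hdiv := hs_div n hn W hW1 hWp
    have hcW : ∀ i, Continuous fun x => pdX n (W i) i x := fun i =>
      ((hW1 i).continuous_fderiv (by simp)).clm_apply continuous_const
    have hcu : Continuous (u' s) := by simp only [hu']; fun_prop
    have hsum := integral_add (hs_cont_int n hcu)
      (hs_cont_int n (continuous_finsetSum Finset.univ fun i _ => hcW i))
    rw [hdiv, add_zero] at hsum
    rw [← hsum]
    refine setIntegral_nonneg (hs_cell_meas n) fun x _ => ?_
    have hlap := H.harmonic (x, h x + s) (by simpa using hs)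
    have hWx : ∀ i, pdX n (W i) i x =
        g (φ (x, h x + s)) * (pdE n (pdE n φ (eX n i)) (eX n i) (x, h x + s)
          + pdX n h i x * pdE n (pdE n φ (eX n i)) (eY n) (x, h x + s))
        + (deriv g (φ (x, h x + s)) * (pdE n φ (eX n i) (x, h x + s)
          + pdX n h i x * pdE n φ (eY n) (x, h x + s))) * pdE n φ (eX n i) (x, h x + s) := by
      intro i
      have hgφ : Differentiable ℝ (fun q => g (φ q)) := hgd.comp hφd
      have d1 : DifferentiableAt ℝ (fun z => g (φ (z, h z + s))) x := by fun_prop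
      have d2 : DifferentiableAt ℝ (fun z => pdE n φ (eX n i) (z, h z + s)) x := by
        have := hD (eX n i)
        fun_prop
      simp only [hW]
      rw [hs_pdX_mul n d1 d2, hs_deriv_x n (hD (eX n i)) hhd,
        hs_deriv_x n (f := fun q => g (φ q)) hgφ hhd,
        hs_pdE_comp n (hgd _) (hφd _), hs_pdE_comp n (hgd _) (hφd _)]
      ring
    have key : u' s x + ∑ i, pdX n (W i) i x =
        deriv g (φ (x, h x + s)) * gradSqE n φ (x, h x + s) +
        g (φ (x, h x + s)) * lapE n φ (x, h x + s) := by
      simp only [hWx, hu', gradSqE, lapE]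
      simp only [mul_sub, mul_add, add_mul, Finset.sum_add_distrib, Finset.mul_sum,
        Finset.sum_mul]
      have e1 : ∑ i, deriv g (φ (x, h x + s)) * (pdX n h i x * pdE n φ (eY n) (x, h x + s)) *
          pdE n φ (eX n i) (x, h x + s) = ∑ i, deriv g (φ (x, h x + s)) *
          pdE n φ (eY n) (x, h x + s) * (pdX n h i x * pdE n φ (eX n i) (x, h x + s)) :=
        Finset.sum_congr rfl fun i _ => by ring
      have e2 : ∑ i, deriv g (φ (x, h x + s)) * pdE n φ (eX n i) (x, h x + s) *
          pdE n φ (eX n i) (x, h x + s) = ∑ i, deriv g (φ (x, h x + s)) *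
          (pdE n φ (eX n i) (x, h x + s)) ^ 2 :=
        Finset.sum_congr rfl fun i _ => by ring
      rw [e1, e2]
      ring
    rw [key, hlap, mul_zero, add_zero]
    exact mul_nonneg (hg' _) (add_nonneg (Finset.sum_nonneg fun i _ => sq_nonneg _) (sq_nonneg _))

lemma hs_key (n : ℕ) (hn : 1 ≤ n) (h φ) (hh : ContDiff ℝ (⊤ : ℕ∞) h) (hp : ZPeriodic n h)
    (H : IsHarmonicExt n h h φ) (g : ℝ → ℝ) (hg : ContDiff ℝ 1 g) (hg' : ∀ s, 0 ≤ deriv g s)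
    (C : ℝ) (hC : ∀ s, |g s| ≤ C) :
    0 ≤ ∫ x in cell n, g (h x) * (pdE n φ (eY n) (x, h x)
      - ∑ i, pdX n h i x * pdE n φ (eX n i) (x, h x)) := by
  have hmono := hs_flux_mono n hn h φ hh hp H g hg hg'
  set w : ℝ → (Fin n → ℝ) → ℝ := fun s x => g (φ (x, h x + s)) * (pdE n φ (eY n) (x, h x + s)
      - ∑ i, pdX n h i x * pdE n φ (eX n i) (x, h x + s)) with hw
  by_contra hneg
  rw [not_le] at hneg
  set c : ℝ := -∫ x in cell n, g (h x) * (pdE n φ (eY n) (x, h x)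
      - ∑ i, pdX n h i x * pdE n φ (eX n i) (x, h x)) with hc
  have hcpos : 0 < c := by rw [hc]; linarith
  have hF : ∀ s ≤ 0, ∫ x in cell n, w s x ≤ -c := by
    intro s hs
    have := hmono (Set.mem_Iic.2 hs) (Set.mem_Iic.2 le_rfl) hs
    simp only [add_zero, H.boundary] at this
    rw [hc, neg_neg]
    exact this
  have hcφ := H.smooth.continuous
  have hch := hh.continuous
  have hcg := hg.continuous
  have hcD : ∀ v, Continuous (pdE n φ v) := fun v => (hs_pdE_smooth n H.smooth v).continuous
  have hcX : ∀ i, Continuous (pdX n h i) := fun i => (hs_pdX_smooth n hh i).continuous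
  have hwc : ∀ s, Continuous (w s) := fun s => by simp only [hw]; fun_prop
  have hΓc : Continuous (gradSqE n φ) := by unfold gradSqE; fun_prop
  have hΓ0 : ∀ p, 0 ≤ gradSqE n φ p := fun p =>
    add_nonneg (Finset.sum_nonneg fun i _ => sq_nonneg _) (sq_nonneg _)
  -- bound on the slope
  obtain ⟨M, hM⟩ := (isCompact_Icc (a := (0 : Fin n → ℝ)) (b := 1)).exists_bound_of_continuousOn
    (f := fun x => 1 + ∑ i, (pdX n h i x) ^ 2) (by fun_prop)
  set K : ℝ := C ^ 2 * M with hK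
  have hpt : ∀ s, ∀ x ∈ cell n, (w s x) ^ 2 ≤ K * gradSqE n φ (x, h x + s) := by
    intro s x hx
    have hMx := (le_abs_self _).trans (hM x (hs_cell_subset n hx))
    have hCS : (pdE n φ (eY n) (x, h x + s)
        - ∑ i, pdX n h i x * pdE n φ (eX n i) (x, h x + s)) ^ 2 ≤
        (1 + ∑ i, (pdX n h i x) ^ 2) * gradSqE n φ (x, h x + s) := by
      have cs := Finset.sum_mul_sq_le_sq_mul_sq Finset.univ (fun i => pdX n h i x)
        (fun i => pdE n φ (eX n i) (x, h x + s))
      unfold gradSqE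
      set A := ∑ i, pdX n h i x * pdE n φ (eX n i) (x, h x + s)
      set P := ∑ i, (pdX n h i x) ^ 2
      set Q := ∑ i, (pdE n φ (eX n i) (x, h x + s)) ^ 2
      set y := pdE n φ (eY n) (x, h x + s)
      have hP : 0 ≤ P := Finset.sum_nonneg fun i _ => sq_nonneg _
      have hQ : 0 ≤ Q := Finset.sum_nonneg fun i _ => sq_nonneg _
      -- need -2 y A ≤ Q + P y^2
      have h1 : (2 * y * A) ^ 2 ≤ (Q + P * y ^ 2) ^ 2 := by
        have := mul_le_mul_of_nonneg_left cs (sq_nonneg y)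
        nlinarith [sq_nonneg (Q - P * y ^ 2)]
      have h2 := abs_le_of_sq_le_sq' h1 (by positivity)
      nlinarith [h2.1]
    have hg2 : (g (φ (x, h x + s))) ^ 2 ≤ C ^ 2 := sq_le_sq' (abs_le.1 (hC _)).1 (abs_le.1 (hC _)).2
    calc (w s x) ^ 2 = (g (φ (x, h x + s))) ^ 2 * (pdE n φ (eY n) (x, h x + s)
        - ∑ i, pdX n h i x * pdE n φ (eX n i) (x, h x + s)) ^ 2 := by simp only [hw]; ring
      _ ≤ C ^ 2 * (M * gradSqE n φ (x, h x + s)) :=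
        mul_le_mul hg2 (hCS.trans (mul_le_mul_of_nonneg_right hMx (hΓ0 _))) (sq_nonneg _)
          (sq_nonneg _)
      _ = _ := by rw [hK]; ring
  have hlow : ∀ s ≤ 0, c ^ 2 ≤ K * ∫ x in cell n, gradSqE n φ (x, h x + s) := by
    intro s hs
    have i1 : IntegrableOn (fun x => (w s x) ^ 2) (cell n) := hs_cont_int n ((hwc s).pow 2)
    have i2 : IntegrableOn (fun x => K * gradSqE n φ (x, h x + s)) (cell n) :=
      hs_cont_int n (by fun_prop)
    have a1 : ∫ x in cell n, (w s x) ^ 2 ≤ K * ∫ x in cell n, gradSqE n φ (x, h x + s) := by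
      rw [← integral_const_mul]
      exact setIntegral_mono_on i1 i2 (hs_cell_meas n) (hpt s)
    have i3 : IntegrableOn (fun _ => c ^ 2) (cell n) := hs_cont_int n continuous_const
    have i4 : IntegrableOn (fun x => 2 * c * w s x) (cell n) :=
      hs_cont_int n (continuous_const.mul (hwc s))
    have a2 : 0 ≤ ∫ x in cell n, ((w s x) ^ 2 + 2 * c * w s x + c ^ 2) :=
      integral_nonneg fun x => by
        simp only [Pi.zero_apply]
        nlinarith [sq_nonneg (w s x + c)]
    have i5 : IntegrableOn (fun x => (w s x) ^ 2 + 2 * c * w s x) (cell n) := i1.add i4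
    rw [integral_add i5 i3, integral_add i1 i4, integral_const_mul] at a2
    have a3 : ∫ _ in cell n, c ^ 2 = c ^ 2 := by
      simp [Measure.real, hs_cell_vol]
    rw [a3] at a2
    nlinarith [hF s hs]
  -- measure preserving shear
  have hmp : MeasurePreserving (fun p : (Fin n → ℝ) × ℝ => (p.1, h p.1 + p.2))
      (volume.prod volume) (volume.prod volume) :=
    MeasurePreserving.skew_product (g := fun x s => h x + s) (MeasurePreserving.id volume)
      (by simp only [Function.uncurry_def]; exact (by fun_prop : Continuous _).measurable)
      (Filter.Eventually.of_forall fun x => (measurePreserving_add_left volume (h x)).map_eq)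
  have hfm : MeasurableSet (fluidCell n h) :=
    ((hs_cell_meas n).preimage measurable_fst).inter
      (measurableSet_lt measurable_snd (hch.measurable.comp measurable_fst))
  have hpre : (fun p : (Fin n → ℝ) × ℝ => (p.1, h p.1 + p.2)) ⁻¹' (fluidCell n h) =
      cell n ×ˢ Set.Iio 0 := by
    ext p
    simp [fluidCell]
  have hI := (hmp.restrict_preimage hfm).integrable_comp_of_integrable H.gradL2
  rw [hpre, ← Measure.prod_restrict] at hI
  have hq := hI.integral_prod_right
  have hbad : Integrable (fun _ : ℝ => c ^ 2) (volume.restrict (Set.Iio (0:ℝ))) := by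
    refine (hq.const_mul K).mono' aestronglyMeasurable_const ?_
    filter_upwards [ae_restrict_mem measurableSet_Iio] with s hs
    rw [Real.norm_of_nonneg (sq_nonneg c)]
    exact hlow s (le_of_lt hs)
  rw [integrable_const_iff] at hbad
  rcases hbad with hb | hb
  · exact (pow_pos hcpos 2).ne' hb
  · have := hb.measure_univ_lt_top
    simp at this

lemma hs_deriv (n : ℕ) (hn : 1 ≤ n) (T : ℝ)
    (h : ℝ → (Fin n → ℝ) → ℝ) (hsol : IsHeleShawSol n T h)
    (Φ : ℝ → ℝ) (hΦC2 : ContDiff ℝ 2 Φ) (hΦconv : ConvexOn ℝ Set.univ Φ) :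
    ∃ D : ℝ → ℝ, (∀ t, HasDerivAt (fun s => ∫ x in cell n, Φ (h s x)) (D t) t) ∧
      ∀ t ∈ Set.Icc 0 T, D t ≤ 0 := by
  have hs := hsol.smooth
  have hsd : Differentiable ℝ (Function.uncurry h) := hs.differentiable (by simp)
  have hdt : ∀ t x, HasDerivAt (fun s => h s x) (fderiv ℝ (Function.uncurry h) (t, x) (1, 0)) t := by
    intro t x
    have h1 : HasDerivAt (fun r : ℝ => ((r, x) : ℝ × (Fin n → ℝ))) (1, 0) t :=
      (hasDerivAt_id t).prodMk (hasDerivAt_const t x)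
    exact (hsd (t, x)).hasFDerivAt.comp_hasDerivAt t h1
  have hΦd : Differentiable ℝ Φ := hΦC2.differentiable (by simp)
  have hΦ' : Continuous (deriv Φ) := hΦC2.continuous_deriv (by norm_num)
  have hdc : Continuous fun p : ℝ × (Fin n → ℝ) => fderiv ℝ (Function.uncurry h) p (1, 0) :=
    (hs.continuous_fderiv (by simp)).clm_apply continuous_const
  refine ⟨fun t => ∫ x in cell n, deriv Φ (h t x) * fderiv ℝ (Function.uncurry h) (t, x) (1, 0),
    ?_, ?_⟩
  · intro t
    refine hs_param n (fun s x => Φ (h s x))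
      (fun t x => deriv Φ (h t x) * fderiv ℝ (Function.uncurry h) (t, x) (1, 0)) ?_ ?_ ?_ t
    · exact hΦC2.continuous.comp hs.continuous
    · exact (hΦ'.comp hs.continuous).mul hdc
    · intro s x
      exact (hΦd (h s x)).hasDerivAt.comp s (hdt s x)
  · intro t ht
    have hht : ContDiff ℝ (⊤ : ℕ∞) (h t) :=
      hs.comp (contDiff_prodMk_right t)
    obtain ⟨R, hR⟩ := (isCompact_Icc (a := (0 : Fin n → ℝ)) (b := 1)).exists_bound_of_continuousOn
      hht.continuous.continuousOn
    obtain ⟨g, hg, hg', ⟨C, hC⟩, hgR⟩ := hs_trunc Φ hΦC2 hΦconv (max R 0) (le_max_right _ _)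
    have H := hsol.extension t ht
    have key := hs_key n hn (h t) H.choose hht (hsol.periodic t) H.choose_spec g hg hg' C hC
    have heq : ∫ x in cell n, deriv Φ (h t x) * fderiv ℝ (Function.uncurry h) (t, x) (1, 0) =
        ∫ x in cell n, -(g (h t x) * (pdE n H.choose (eY n) (x, h t x)
          - ∑ i, pdX n (h t) i x * pdE n H.choose (eX n i) (x, h t x))) := by
      refine setIntegral_congr_fun (hs_cell_meas n) fun x hx => ?_
      have e1 := hsol.equation t ht x
      rw [(hdt t x).deriv, DtN, dif_pos H] at e1
      have e2 := hgR (h t x) ((hR x (hs_cell_subset n hx)).trans (le_max_left _ _))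
      rw [e2, eq_neg_of_add_eq_zero_left e1]
      ring
    simp only [heq, integral_neg]
    linarith

/-- For a smooth solution of the Hele-Shaw equation and a C² convex
nonnegative Φ, the functional I_Φ(t) = ∫_{𝕋ⁿ} Φ(h(t,x)) dx is non-increasing on [0,T],
i.e. (d/dt)I_Φ(t) ≤ 0 for all t ∈ [0,T]. -/
theorem heleShaw_lyapunov (n : ℕ) (hn : 1 ≤ n) (T : ℝ) (hT : 0 ≤ T)
    (h : ℝ → (Fin n → ℝ) → ℝ) (hsol : IsHeleShawSol n T h)
    (Φ : ℝ → ℝ) (hΦpos : ∀ s, 0 ≤ Φ s) (hΦC2 : ContDiff ℝ 2 Φ)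
    (hΦconv : ConvexOn ℝ Set.univ Φ) :
    AntitoneOn (fun t => ∫ x in cell n, Φ (h t x)) (Set.Icc 0 T) ∧
    ∀ t ∈ Set.Icc 0 T, deriv (fun s => ∫ x in cell n, Φ (h s x)) t ≤ 0 := by
  obtain ⟨D, hD, hD0⟩ := hs_deriv n hn T h hsol Φ hΦC2 hΦconv
  refine ⟨antitoneOn_of_deriv_nonpos (convex_Icc 0 T) ?_ ?_ ?_, ?_⟩
  · exact fun t _ => (hD t).continuousAt.continuousWithinAt
  · exact fun t _ => (hD t).differentiableAt.differentiableWithinAt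
  · intro t ht
    rw [(hD t).deriv]
    exact hD0 t (interior_subset ht)
  · intro t ht
    rw [(hD t).deriv]
    exact hD0 t ht

end
end

section
/- Let h : 𝕋ⁿ → ℝ and ψ : 𝕋ⁿ → ℝ be smooth. Then G(h)(B(h)ψ) = −div(V(h)ψ) as functions on 𝕋ⁿ. -/
open MeasureTheory
open scoped Classical

noncomputable section

/-! ### Calculus preliminaries -/

local notation "sm" => ((⊤ : ℕ∞) : WithTop ℕ∞)

lemma sm_ne_zero : sm ≠ 0 := by simp

lemma pdE_smooth {n : ℕ} {φ : (Fin n → ℝ) × ℝ → ℝ} (hφ : ContDiff ℝ sm φ)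
    (v : (Fin n → ℝ) × ℝ) : ContDiff ℝ sm (pdE n φ v) := by
  unfold pdE
  have : ContDiff ℝ sm (fderiv ℝ φ) := hφ.fderiv_right (by simp)
  exact this.clm_apply contDiff_const

lemma pdX_smooth {n : ℕ} {f : (Fin n → ℝ) → ℝ} (hf : ContDiff ℝ sm f)
    (i : Fin n) : ContDiff ℝ sm (pdX n f i) := by
  unfold pdX
  have : ContDiff ℝ sm (fderiv ℝ f) := hf.fderiv_right (by simp)
  exact this.clm_apply contDiff_const

lemma pdE_mul {n : ℕ} {f g : (Fin n → ℝ) × ℝ → ℝ} (hf : ContDiff ℝ sm f) (hg : ContDiff ℝ sm g)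
    (v p : (Fin n → ℝ) × ℝ) :
    pdE n (fun q => f q * g q) v p = f p * pdE n g v p + pdE n f v p * g p := by
  unfold pdE
  rw [fderiv_fun_mul (hf.differentiable sm_ne_zero p) (hg.differentiable sm_ne_zero p)]
  simp [mul_comm]

lemma pdE_comm {n : ℕ} {φ : (Fin n → ℝ) × ℝ → ℝ} (hφ : ContDiff ℝ sm φ)
    (v w p : (Fin n → ℝ) × ℝ) : pdE n (pdE n φ v) w p = pdE n (pdE n φ w) v p := by
  have hd : DifferentiableAt ℝ (fderiv ℝ φ) p :=
    ((hφ.fderiv_right (m := sm) (by simp)).differentiable sm_ne_zero p)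
  have key : ∀ v w, pdE n (pdE n φ v) w p = fderiv ℝ (fderiv ℝ φ) p w v := by
    intro v w
    unfold pdE
    rw [fderiv_clm_apply hd (differentiableAt_const _)]
    simp
  rw [key, key]
  exact (hφ.contDiffAt.isSymmSndFDerivAt (by
    simp only [minSmoothness_of_isRCLikeNormedField]
    exact WithTop.coe_le_coe.2 (le_top : (2 : ℕ∞) ≤ ⊤))).eq _ _

/-- flattening -/
def flat (n : ℕ) (h : (Fin n → ℝ) → ℝ) (p : (Fin n → ℝ) × ℝ) : (Fin n → ℝ) × ℝ :=
  (p.1, h p.1 + p.2)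

lemma flat_smooth {n : ℕ} {h : (Fin n → ℝ) → ℝ} (hh : ContDiff ℝ sm h) :
    ContDiff ℝ sm (flat n h) :=
  contDiff_fst.prodMk ((hh.comp contDiff_fst).add contDiff_snd)

lemma pdX_slice {n : ℕ} {h : (Fin n → ℝ) → ℝ} (hh : ContDiff ℝ sm h)
    {v : (Fin n → ℝ) × ℝ → ℝ} (hv : ContDiff ℝ sm v) (z : ℝ) (i : Fin n) (x : Fin n → ℝ) :
    pdX n (fun x => v (x, h x + z)) i x
      = pdE n v (eX n i) (x, h x + z) + pdX n h i x * pdE n v (eY n) (x, h x + z) := by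
  have h1 : HasFDerivAt (fun x => (x, h x + z)) ((ContinuousLinearMap.id ℝ (Fin n → ℝ)).prod
      (fderiv ℝ h x)) x :=
    (hasFDerivAt_id x).prodMk ((hh.differentiable sm_ne_zero x).hasFDerivAt.add_const z)
  have h2 := ((hv.differentiable sm_ne_zero (x, h x + z)).hasFDerivAt).comp x h1
  unfold pdX pdE
  have h3 : fderiv ℝ (fun x => v (x, h x + z)) x = _ := h2.fderiv
  rw [h3]
  have : (((Pi.single i 1 : Fin n → ℝ), fderiv ℝ h x (Pi.single i 1)) : (Fin n → ℝ) × ℝ)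
      = eX n i + fderiv ℝ h x (Pi.single i 1) • eY n := by
    ext <;> simp [eX, eY]
  simp only [ContinuousLinearMap.comp_apply, ContinuousLinearMap.prod_apply,
    ContinuousLinearMap.id_apply]
  rw [this]
  simp

lemma hasDerivAt_slice {n : ℕ} {h : (Fin n → ℝ) → ℝ}
    {v : (Fin n → ℝ) × ℝ → ℝ} (hv : ContDiff ℝ sm v) (z : ℝ) (x : Fin n → ℝ) :
    HasDerivAt (fun z => v (x, h x + z)) (pdE n v (eY n) (x, h x + z)) z := by
  have h1 : HasDerivAt (fun z : ℝ => (x, h x + z)) (eY n) z := by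
    have := (hasDerivAt_const z x).prodMk ((hasDerivAt_id z).const_add (h x))
    simpa [eY] using this
  exact ((hv.differentiable sm_ne_zero (x, h x + z)).hasFDerivAt).comp_hasDerivAt z h1

/-- closed unit box -/
abbrev box (n : ℕ) : Set (Fin n → ℝ) := Set.Icc 0 1

lemma box_int {n : ℕ} {f : (Fin n → ℝ) → ℝ} (hf : Continuous f) : IntegrableOn f (box n) :=
  hf.continuousOn.integrableOn_compact isCompact_Icc

/-- differentiation under the integral -/
lemma hasDerivAt_boxint {n : ℕ} {F F' : ℝ → (Fin n → ℝ) → ℝ}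
    (hF : Continuous (Function.uncurry F)) (hF' : Continuous (Function.uncurry F'))
    (hd : ∀ z x, HasDerivAt (fun z => F z x) (F' z x) z) (z : ℝ) :
    HasDerivAt (fun z => ∫ x in box n, F z x) (∫ x in box n, F' z x) z := by
  obtain ⟨C, hC⟩ := ((isCompact_Icc (a := z - 1) (b := z + 1)).prod
    (isCompact_Icc (a := (0 : Fin n → ℝ)) (b := 1))).exists_bound_of_continuousOn
    hF'.continuousOn
  have hc : ∀ z, Continuous (F z) := fun z => hF.comp (by fun_prop : Continuous fun x => (z, x))
  have hc' : ∀ z, Continuous (F' z) := fun z => hF'.comp (by fun_prop : Continuous fun x => (z, x))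
  refine (hasDerivAt_integral_of_dominated_loc_of_deriv_le (s := Set.Icc (z-1) (z+1))
    (bound := fun _ => C) (Icc_mem_nhds (by linarith) (by linarith)) ?_ (box_int (hc z))
    (hc' z).aestronglyMeasurable ?_ ?_ ?_).2
  · exact Filter.Eventually.of_forall fun z => (hc z).aestronglyMeasurable
  · refine (ae_restrict_mem measurableSet_Icc).mono fun x hx y hy => ?_
    exact hC (y, x) ⟨hy, hx⟩
  · exact box_int continuous_const
  · exact Filter.Eventually.of_forall fun x y _ => hd y x

lemma integral_pdX_zero {n : ℕ} {g : (Fin n → ℝ) → ℝ} (hg : ContDiff ℝ sm g)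
    (hp : ZPeriodic n g) (i : Fin n) : ∫ x in box n, pdX n g i x = 0 := by
  obtain _ | n := n
  · exact i.elim0
  have hpd : ∀ j x, (if j = i then fderiv ℝ g x else 0 : (Fin (n+1) → ℝ) →L[ℝ] ℝ)
      (Pi.single j 1) = if j = i then pdX (n+1) g i x else 0 := by
    intro j x
    split_ifs with hj
    · subst hj; rfl
    · rfl
  have := integral_divergence_of_hasFDerivAt_off_countable' (n := n) (0 : Fin (n+1) → ℝ) 1
    (fun i => by simp) (fun j x => if j = i then g x else 0)
    (fun j x => if j = i then fderiv ℝ g x else 0) ∅ Set.countable_empty ?_ ?_ ?_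
  · simp only [hpd, Finset.sum_ite_eq', Finset.mem_univ, if_true] at this
    rw [this]
    refine Finset.sum_eq_zero fun j _ => ?_
    split_ifs with hj
    · rw [sub_eq_zero]
      congr 1
      ext x
      rw [← hp (j.insertNth ((0 : Fin (n+1) → ℝ) j) x) (Pi.single j 1)]
      congr 1
      ext k
      refine Fin.succAboveCases j ?_ (fun l => ?_) k
      · simp
      · simp [Fin.succAbove_ne]
    · simp
  · intro j
    split_ifs
    · exact hg.continuous.continuousOn
    · exact continuousOn_const
  · intro x _ j
    split_ifs
    · exact (hg.differentiable sm_ne_zero x).hasFDerivAt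
    · exact hasFDerivAt_const _ _
  · simp only [hpd, Finset.sum_ite_eq', Finset.mem_univ, if_true]
    exact box_int (pdX_smooth hg i).continuous

/-! ### One-dimensional differential inequalities -/

lemma mono_of_deriv {M D : ℝ → ℝ} {a : ℝ} (hM : ∀ z < a, HasDerivAt M (D z) z)
    (hD : ∀ z < a, 0 ≤ D z) : MonotoneOn M (Set.Iio a) := by
  refine monotoneOn_of_hasDerivWithinAt_nonneg (f' := D) (convex_Iio a)
    (fun z hz => (hM z hz).continuousAt.continuousWithinAt) ?_ ?_
  · intro z hz
    rw [interior_Iio] at hz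
    exact (hM z hz).hasDerivWithinAt
  · intro z hz
    rw [interior_Iio] at hz
    exact hD z hz

lemma ode_cacc {J g f : ℝ → ℝ} {C E : ℝ} (hC : 0 < C)
    (hJ : ∀ z < 0, HasDerivAt J (g z) z) (hg : ∀ z < 0, 0 ≤ g z)
    (hf : Continuous f) (hE : ∀ z < 0, ∫ t in z..0, f t ≤ E)
    (hK : ∀ z < 0, ∀ s > 0, - J z ≤ (s * f z + C * g z / s) / 2) :
    ∀ z < 0, 0 ≤ J z := by
  intro z0 hz0
  by_contra hneg
  push Not at hneg
  have hmono := mono_of_deriv hJ hg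
  have hlt : ∀ z ≤ z0, J z < 0 := fun z hz =>
    lt_of_le_of_lt (hmono (lt_of_le_of_lt hz hz0) hz0 hz) hneg
  set P : ℝ → ℝ := fun z => -(J z)⁻¹ - (2 * z - ∫ t in (0:ℝ)..z, f t) / C with hP
  have hPd : ∀ z < z0, HasDerivAt P (-(-(g z) / (J z)^2) - (2 * 1 - f z) / C) z := by
    intro z hz
    have h1 := ((hJ z (hz.trans hz0)).fun_inv (hlt z hz.le).ne).fun_neg
    have h2 : HasDerivAt (fun z => ∫ t in (0:ℝ)..z, f t) (f z) z :=
      intervalIntegral.integral_hasDerivAt_right (hf.intervalIntegrable _ _)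
        hf.stronglyMeasurable.stronglyMeasurableAtFilter hf.continuousAt
    exact h1.fun_sub ((((hasDerivAt_id z).const_mul 2).fun_sub h2).div_const C)
  have hPm := mono_of_deriv hPd (fun z hz => by
    have hj := hlt z hz.le
    have h1 := hK z (hz.trans hz0) (-J z) (by linarith)
    have h2 : (2 - f z) / C ≤ g z / (J z)^2 := by
      rw [div_le_div_iff₀ hC (sq_pos_of_neg hj)]
      rw [le_div_iff₀ (by norm_num)] at h1
      have h3 : C * g z / (-J z) * (-J z) = C * g z := div_mul_cancel₀ _ (by linarith)
      nlinarith
    have h4 : -(-(g z) / (J z)^2) = g z / (J z)^2 := by ring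
    rw [h4]; linarith)
  set w := z0 - 1
  have hw : w < z0 := by simp [w]
  set z := min w (-(|P w| * C + |E| + 1)) with hzdef
  have hz1 : z ≤ w := min_le_left _ _
  have hz2 : z ≤ -(|P w| * C + |E| + 1) := min_le_right _ _
  have h1 := hPm (show z < z0 by linarith) hw hz1
  have h2 : 0 < -(J z)⁻¹ := by
    have := inv_lt_zero.2 (hlt z (by linarith))
    linarith
  have h3 := hE z (by linarith)
  rw [intervalIntegral.integral_symm] at h3
  have h4 : - (2 * z - ∫ t in (0:ℝ)..z, f t) / C < P w := by
    have : P z = -(J z)⁻¹ - (2 * z - ∫ t in (0:ℝ)..z, f t) / C := rfl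
    rw [neg_div]
    linarith
  rw [div_lt_iff₀ hC] at h4
  have h5 : P w * C ≤ |P w| * C := by gcongr; exact le_abs_self _
  have h6 := le_abs_self E
  have h7 : 0 ≤ |P w| * C := by positivity
  have h8 := abs_nonneg E
  linarith

lemma ode_uniq {J g f F : ℝ → ℝ} {C E : ℝ} (hC : 0 < C)
    (hJ : ∀ z < 0, HasDerivAt J (g z) z) (hg : ∀ z < 0, 0 ≤ g z)
    (hJc : ContinuousAt J 0) (hJ0 : J 0 = 0) (hE : ∀ z < 0, -J z ≤ E)
    (hf : ∀ z, HasDerivAt f (F z) z) (hf0 : f 0 = 0) (hF0 : F 0 = 0)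
    (hF : ∀ z < 0, ∀ s > 0, -F z ≤ s * f z + g z / s)
    (hK : ∀ z < 0, ∀ s > 0, - J z ≤ (s * f z + C * g z / s) / 2) :
    ∀ z < 0, J z = 0 := by
  have hmono := mono_of_deriv hJ hg
  -- step 1
  set M : ℝ → ℝ := fun z => J z - f z / z with hM
  have hMd : ∀ z < 0, HasDerivAt M (g z - (F z * z - f z * 1) / z^2) z := fun z hz =>
    (hJ z hz).fun_sub ((hf z).fun_div (hasDerivAt_id z) hz.ne)
  have hMm := mono_of_deriv hMd (fun z hz => by
    have h1 := hF z hz (-z)⁻¹ (by rw [gt_iff_lt, inv_pos]; linarith)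
    rw [sub_nonneg, div_le_iff₀ (by nlinarith [sq_pos_of_neg hz])]
    have h2 : (-F z) * (-z) ≤ ((-z)⁻¹ * f z + g z / (-z)⁻¹) * (-z) :=
      mul_le_mul_of_nonneg_right h1 (by linarith)
    have h3 : ((-z)⁻¹ * f z + g z / (-z)⁻¹) * (-z) = f z + g z * z^2 := by
      have := hz.ne
      field_simp
      ring
    nlinarith)
  have hlim : Filter.Tendsto M (nhdsWithin 0 (Set.Iio 0)) (nhds 0) := by
    have h1 : Filter.Tendsto J (nhdsWithin 0 (Set.Iio 0)) (nhds 0) := by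
      have := hJc.tendsto.mono_left (nhdsWithin_le_nhds (s := Set.Iio (0:ℝ)))
      rwa [hJ0] at this
    have h2 := (hasDerivAt_iff_tendsto_slope.1 (hf 0)).mono_left
      (nhdsWithin_mono 0 (fun z (hz : z < 0) => hz.ne))
    rw [hF0] at h2
    have := h1.sub h2
    rw [sub_zero] at this
    refine this.congr fun z => ?_
    simp [hM, slope_def_field, hf0]
  have hMle : ∀ z < 0, M z ≤ 0 := by
    intro z hz
    refine ge_of_tendsto hlim ?_
    have : Set.Ioo z 0 ∈ nhdsWithin (0:ℝ) (Set.Iio 0) := Ioo_mem_nhdsLT hz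
    filter_upwards [this] with y hy
    exact hMm hz hy.2 hy.1.le
  -- step 2
  have hKg : ∀ z < 0, -J z ≤ C * (-z) * g z := by
    intro z hz
    have h1 := hK z hz (-z)⁻¹ (by rw [gt_iff_lt, inv_pos]; linarith)
    have h2 := hMle z hz
    have h3 : (-z)⁻¹ * f z = - (f z / z) := by
      have := hz.ne
      field_simp
    have h4 : C * g z / (-z)⁻¹ = C * (-z) * g z := by
      rw [div_inv_eq_mul]; ring
    rw [h3, h4] at h1
    simp only [hM] at h2
    linarith
  -- step 3
  have hle : ∀ z < 0, J z ≤ 0 := by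
    intro z hz
    have h1 : Filter.Tendsto J (nhdsWithin 0 (Set.Iio 0)) (nhds 0) := by
      have := hJc.tendsto.mono_left (nhdsWithin_le_nhds (s := Set.Iio (0:ℝ)))
      rwa [hJ0] at this
    refine ge_of_tendsto h1 ?_
    filter_upwards [Ioo_mem_nhdsLT hz] with y hy
    exact hmono hz hy.2 hy.1.le
  intro z0 hz0
  by_contra hne
  have hk : 0 < -J z0 := by
    have := lt_of_le_of_ne (hle z0 hz0) hne
    linarith
  set k := -J z0 with hkdef
  set N : ℝ → ℝ := fun z => J z + k / C * Real.log z with hN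
  have hNd : ∀ z < z0, HasDerivAt N (g z + k / C * z⁻¹) z := fun z hz =>
    (hJ z (hz.trans hz0)).fun_add ((Real.hasDerivAt_log (hz.trans hz0).ne).const_mul _)
  have hNm := mono_of_deriv hNd (fun z hz => by
    have hz' := hz.trans hz0
    have h1 := hKg z hz'
    have h2 : k ≤ -J z := by
      have := hmono hz' hz0 hz.le
      linarith
    have h3 : k / (C * (-z)) ≤ g z := by
      rw [div_le_iff₀ (by nlinarith)]
      linarith
    have h4 : k / C * z⁻¹ = - (k / (C * (-z))) := by
      have := hz'.ne
      have := hC.ne'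
      field_simp
    linarith)
  have ht : Filter.Tendsto (fun t : ℝ => k / C * Real.log t) Filter.atTop Filter.atTop :=
    Real.tendsto_log_atTop.const_mul_atTop (by positivity)
  obtain ⟨t, ht1, ht2⟩ := ((Filter.tendsto_atTop.1 ht (N (z0 - 1) + E + 1)).and
    (Filter.eventually_ge_atTop (-(z0 - 1)))).exists
  have h1 := hNm (show -t < z0 by linarith) (show z0 - 1 < z0 by linarith)
    (show -t ≤ z0 - 1 by linarith)
  have h2 := hE (-t) (by linarith)
  have h3 : N (-t) = J (-t) + k / C * Real.log t := by simp [hN]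
  linarith

/-! ### Slice integrals -/

/-- integral of `v` over the slice `y = h x + z` -/
def sl (n : ℕ) (h : (Fin n → ℝ) → ℝ) (v : (Fin n → ℝ) × ℝ → ℝ) (z : ℝ) : ℝ :=
  ∫ x in box n, v (x, h x + z)

lemma slice_cont {n : ℕ} {h : (Fin n → ℝ) → ℝ} (hh : Continuous h)
    {v : (Fin n → ℝ) × ℝ → ℝ} (hv : Continuous v) (z : ℝ) :
    Continuous (fun x => v (x, h x + z)) := by fun_prop

lemma sl_deriv {n : ℕ} {h : (Fin n → ℝ) → ℝ} (hh : Continuous h)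
    {v : (Fin n → ℝ) × ℝ → ℝ} (hv : ContDiff ℝ sm v) (z : ℝ) :
    HasDerivAt (sl n h v) (sl n h (pdE n v (eY n)) z) z := by
  have h1 := hv.continuous
  have h2 := (pdE_smooth hv (eY n)).continuous
  exact hasDerivAt_boxint (F := fun z x => v (x, h x + z))
    (F' := fun z x => pdE n v (eY n) (x, h x + z))
    (by unfold Function.uncurry; fun_prop) (by unfold Function.uncurry; fun_prop)
    (fun z x => hasDerivAt_slice hv z x) z

lemma sl_cont {n : ℕ} {h : (Fin n → ℝ) → ℝ} (hh : Continuous h)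
    {v : (Fin n → ℝ) × ℝ → ℝ} (hv : ContDiff ℝ sm v) : Continuous (sl n h v) :=
  continuous_iff_continuousAt.2 fun z => (sl_deriv hh hv z).continuousAt

lemma sl_nonneg {n : ℕ} {h : (Fin n → ℝ) → ℝ}
    {v : (Fin n → ℝ) × ℝ → ℝ} (hv : ∀ p, 0 ≤ v p) (z : ℝ) : 0 ≤ sl n h v z :=
  integral_nonneg fun _ => hv _

lemma gradSqE_smooth {n : ℕ} {φ : (Fin n → ℝ) × ℝ → ℝ} (hφ : ContDiff ℝ sm φ) :
    ContDiff ℝ sm (gradSqE n φ) := by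
  unfold gradSqE
  exact (ContDiff.sum fun i _ => (pdE_smooth hφ _).pow 2).add ((pdE_smooth hφ _).pow 2)

lemma lapE_smooth {n : ℕ} {φ : (Fin n → ℝ) × ℝ → ℝ} (hφ : ContDiff ℝ sm φ) :
    ContDiff ℝ sm (lapE n φ) := by
  unfold lapE
  exact (ContDiff.sum fun i _ => pdE_smooth (pdE_smooth hφ _) _).add
    (pdE_smooth (pdE_smooth hφ _) _)

lemma gradSqE_nonneg {n : ℕ} (φ : (Fin n → ℝ) × ℝ → ℝ) (p) : 0 ≤ gradSqE n φ p := by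
  unfold gradSqE
  positivity

lemma pdE_periodic {n : ℕ} {φ : (Fin n → ℝ) × ℝ → ℝ} (hφ : ZPeriodicE n φ)
    (v : (Fin n → ℝ) × ℝ) : ZPeriodicE n (pdE n φ v) := by
  intro x y k
  unfold pdE
  have h1 : (fun p => φ (p + ((fun i => (k i : ℝ)), (0:ℝ)))) = φ := by
    ext ⟨a, b⟩
    simpa using hφ a b k
  have h2 := fderiv_comp_add_right (𝕜 := ℝ) (f := φ) (x := (x, y)) ((fun i => (k i : ℝ)), (0:ℝ))
  rw [h1] at h2
  rw [h2]
  simp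

/-- the flux -/
def flux (n : ℕ) (h : (Fin n → ℝ) → ℝ) (u : (Fin n → ℝ) × ℝ → ℝ) (z : ℝ) : ℝ :=
  ∫ x in box n, (u (x, h x + z) * pdE n u (eY n) (x, h x + z)
    - ∑ i, pdX n h i x * (u (x, h x + z) * pdE n u (eX n i) (x, h x + z)))

lemma flux_deriv {n : ℕ} {h : (Fin n → ℝ) → ℝ} (hh : ContDiff ℝ sm h) (hp : ZPeriodic n h)
    {u : (Fin n → ℝ) × ℝ → ℝ} (hu : ContDiff ℝ sm u) (hup : ZPeriodicE n u) (z : ℝ) :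
    HasDerivAt (flux n h u) (sl n h (fun p => gradSqE n u p + u p * lapE n u p) z) z := by
  have hY := pdE_smooth hu (eY n)
  have hX := fun i => pdE_smooth hu (eX n i)
  have hFY : ContDiff ℝ sm (fun p => u p * pdE n u (eY n) p) := hu.mul hY
  have hFX : ∀ i, ContDiff ℝ sm (fun p => u p * pdE n u (eX n i) p) := fun i => hu.mul (hX i)
  have c0 := hh.continuous
  have c1 := fun i => (pdX_smooth hh i).continuous
  have c2 := hFY.continuous
  have c3 := fun i => (hFX i).continuous
  have c4 := (pdE_smooth hFY (eY n)).continuous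
  have c5 := fun i => (pdE_smooth (hFX i) (eY n)).continuous
  have key := hasDerivAt_boxint (n := n)
    (F := fun z x => (fun p => u p * pdE n u (eY n) p) (x, h x + z)
      - ∑ i, pdX n h i x * (fun p => u p * pdE n u (eX n i) p) (x, h x + z))
    (F' := fun z x => pdE n (fun p => u p * pdE n u (eY n) p) (eY n) (x, h x + z)
      - ∑ i, pdX n h i x * pdE n (fun p => u p * pdE n u (eX n i) p) (eY n) (x, h x + z))
    (by
      unfold Function.uncurry
      refine (c2.comp (by fun_prop)).sub (continuous_finsetSum _ fun i _ =>
        ((c1 i).comp continuous_snd).mul ((c3 i).comp (by fun_prop))))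
    (by
      unfold Function.uncurry
      refine (c4.comp (by fun_prop)).sub (continuous_finsetSum _ fun i _ =>
        ((c1 i).comp continuous_snd).mul ((c5 i).comp (by fun_prop))))
    (fun z x => (hasDerivAt_slice hFY z x).fun_sub (HasDerivAt.fun_sum fun i _ =>
      (hasDerivAt_slice (hFX i) z x).const_mul _)) z
  have hsl : ∀ i, ContDiff ℝ sm (fun x => (fun p => u p * pdE n u (eX n i) p) (x, h x + z)) :=
    fun i => (hFX i).comp (contDiff_id.prodMk (hh.add contDiff_const))
  have hz : ∀ i, ∫ x in box n, pdX n
      (fun x => (fun p => u p * pdE n u (eX n i) p) (x, h x + z)) i x = 0 := by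
    intro i
    refine integral_pdX_zero (hsl i) ?_ i
    intro x k
    simp only [hp x k, hup x _ k, pdE_periodic hup _ x _ k]
  have heq : sl n h (fun p => gradSqE n u p + u p * lapE n u p) z =
      ∫ x in box n, (pdE n (fun p => u p * pdE n u (eY n) p) (eY n) (x, h x + z)
      - ∑ i, pdX n h i x * pdE n (fun p => u p * pdE n u (eX n i) p) (eY n) (x, h x + z)) := by
    have e1 : ∀ x, gradSqE n u (x, h x + z) + u (x, h x + z) * lapE n u (x, h x + z) =
      (pdE n (fun p => u p * pdE n u (eY n) p) (eY n) (x, h x + z)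
      - ∑ i, pdX n h i x * pdE n (fun p => u p * pdE n u (eX n i) p) (eY n) (x, h x + z))
      + ∑ i, pdX n (fun x => (fun p => u p * pdE n u (eX n i) p) (x, h x + z)) i x := by
      intro x
      simp only [pdX_slice hh (hFX _), pdE_mul hu hY, pdE_mul hu (hX _), gradSqE, lapE]
      simp only [Finset.sum_add_distrib, mul_add, Finset.mul_sum, sq]
      ring
    unfold sl
    simp only [e1]
    rw [integral_add, integral_finsetSum]
    · rw [Finset.sum_eq_zero (fun i _ => hz i), add_zero]
    · exact fun i _ => box_int (pdX_smooth (hsl i) i).continuous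
    · exact box_int (by
        refine (c4.comp (by fun_prop)).sub (continuous_finsetSum _ fun i _ =>
          (c1 i).mul ((c5 i).comp (by fun_prop))))
    · exact box_int (continuous_finsetSum _ fun i _ => (pdX_smooth (hsl i) i).continuous)
  rw [heq]
  exact key

lemma slope_bound {n : ℕ} {h : (Fin n → ℝ) → ℝ} (hh : ContDiff ℝ sm h) :
    ∃ C > 0, ∀ x ∈ box n, 1 + ∑ i, (pdX n h i x)^2 ≤ C := by
  have hc : Continuous (fun x => 1 + ∑ i, (pdX n h i x)^2) :=
    continuous_const.add (continuous_finsetSum _ fun i _ => (pdX_smooth hh i).continuous.pow 2)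
  obtain ⟨C, hC⟩ := (isCompact_Icc (a := (0 : Fin n → ℝ)) (b := 1)).exists_bound_of_continuousOn
    hc.continuousOn
  refine ⟨|C| + 1, by positivity, fun x hx => ?_⟩
  have h1 := (le_abs_self _).trans (hC x hx)
  have h2 := le_abs_self C
  linarith

lemma flux_bound {n : ℕ} {h : (Fin n → ℝ) → ℝ} (hh : ContDiff ℝ sm h)
    {u : (Fin n → ℝ) × ℝ → ℝ} (hu : ContDiff ℝ sm u) {C : ℝ}
    (hC : ∀ x ∈ box n, 1 + ∑ i, (pdX n h i x)^2 ≤ C) (z s : ℝ) (hs : 0 < s) :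
    - flux n h u z ≤ (s * sl n h (fun p => (u p)^2) z + C * sl n h (gradSqE n u) z / s) / 2 := by
  have c0 := hh.continuous
  have c1 := fun i => (pdX_smooth hh i).continuous
  have c2 := (hu.mul (pdE_smooth hu (eY n))).continuous
  have c3 := fun i => (hu.mul (pdE_smooth hu (eX n i))).continuous
  have i1 := box_int (slice_cont c0 (hu.pow 2).continuous z)
  have i2 := box_int (slice_cont c0 (gradSqE_smooth hu).continuous z)
  have e : (s * sl n h (fun p => (u p)^2) z + C * sl n h (gradSqE n u) z / s) / 2 =
      ∫ x in box n, ((s/2) * (u (x, h x + z))^2 + (C / s / 2) * gradSqE n u (x, h x + z)) := by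
    rw [integral_add (i1.const_mul _) (i2.const_mul _), integral_const_mul, integral_const_mul]
    unfold sl
    ring
  rw [e, flux, ← integral_neg]
  refine setIntegral_mono_on ?_ ((i1.const_mul _).add (i2.const_mul _)) measurableSet_Icc ?_
  · refine (box_int ?_).neg
    exact (c2.comp (by fun_prop)).sub (continuous_finsetSum _ fun i _ =>
          (c1 i).mul ((c3 i).comp (by fun_prop)))
  · intro x hx
    have hCx := hC x hx
    set p := (x, h x + z)
    set N := pdE n u (eY n) p - ∑ i, pdX n h i x * pdE n u (eX n i) p with hN
    have e2 : u p * pdE n u (eY n) p - ∑ i, pdX n h i x * (u p * pdE n u (eX n i) p)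
        = u p * N := by
      rw [hN, mul_sub, Finset.mul_sum]
      congr 1
      exact Finset.sum_congr rfl fun i _ => by ring
    rw [e2]
    have hcs := Finset.sum_mul_sq_le_sq_mul_sq Finset.univ (fun i => pdX n h i x)
      (fun i => pdE n u (eX n i) p)
    have hg : gradSqE n u p = (∑ i, (pdE n u (eX n i) p)^2) + (pdE n u (eY n) p)^2 := rfl
    have hA : 0 ≤ ∑ i, (pdX n h i x)^2 := by positivity
    have hB : 0 ≤ ∑ i, (pdE n u (eX n i) p)^2 := by positivity
    set S := ∑ i, pdX n h i x * pdE n u (eX n i) p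
    set A := ∑ i, (pdX n h i x)^2
    set B := ∑ i, (pdE n u (eX n i) p)^2
    set b := pdE n u (eY n) p
    have hN2 : N^2 ≤ C * gradSqE n u p := by
      have h1 : N^2 ≤ (1 + A) * (B + b^2) := by
        have : (b * S) * 2 ≥ - (A * b^2 + B) := by
          rcases hA.eq_or_lt with hA0 | hA0
          · have : S = 0 := by nlinarith
            rw [this]; nlinarith [mul_nonneg hA (sq_nonneg b)]
          · have h5 : 0 ≤ A * (A * b^2 + B + (b * S) * 2) := by
              nlinarith [sq_nonneg (A * b + S)]
            have := nonneg_of_mul_nonneg_right h5 hA0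
            linarith
        rw [hN]
        nlinarith
      rw [hg]
      exact h1.trans (mul_le_mul_of_nonneg_right hCx (by positivity))
    have h3 : -(u p * N) ≤ s / 2 * u p ^ 2 + N^2 / s / 2 := by
      have : s / 2 * u p ^ 2 + N^2 / s / 2 + u p * N = (s * u p + N)^2 / s / 2 := by
        field_simp
        ring
      have : 0 ≤ (s * u p + N)^2 / s / 2 := by positivity
      linarith
    have h4 : N^2 / s / 2 ≤ C * gradSqE n u p / s / 2 := by gcongr
    calc _ ≤ _ := h3
      _ ≤ s / 2 * u p ^ 2 + C * gradSqE n u p / s / 2 := by linarith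
      _ = _ := by ring

/-! ### Flattening the domain -/

lemma flat_mp {n : ℕ} {h : (Fin n → ℝ) → ℝ} (hh : Continuous h) :
    MeasurePreserving (flat n h) volume volume := by
  have := (MeasurePreserving.id (volume : Measure (Fin n → ℝ))).skew_product
    (μc := (volume : Measure ℝ)) (μd := (volume : Measure ℝ)) (g := fun x z => h x + z)
    (by unfold Function.uncurry; fun_prop)
    (Filter.Eventually.of_forall fun x => (measurePreserving_add_left volume (h x)).map_eq)
  exact this

lemma flat_emb {n : ℕ} {h : (Fin n → ℝ) → ℝ} (hh : Continuous h) :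
    MeasurableEmbedding (flat n h) := by
  let e : ((Fin n → ℝ) × ℝ) ≃ₜ ((Fin n → ℝ) × ℝ) :=
    { toFun := flat n h
      invFun := fun p => (p.1, p.2 - h p.1)
      left_inv := fun p => by simp [flat]
      right_inv := fun p => by simp [flat]
      continuous_toFun := by unfold flat; fun_prop
      continuous_invFun := by fun_prop }
  exact e.measurableEmbedding

lemma integrableOn_flat {n : ℕ} {h : (Fin n → ℝ) → ℝ} (hh : Continuous h)
    (v : (Fin n → ℝ) × ℝ → ℝ) :
    IntegrableOn v (fluidCell n h) ↔
      Integrable (fun p : (Fin n → ℝ) × ℝ => v (p.1, h p.1 + p.2))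
        ((volume.restrict (box n)).prod (volume.restrict (Set.Iio (0:ℝ)))) := by
  rw [← (flat_mp hh).integrableOn_comp_preimage (flat_emb hh)]
  have h1 : flat n h ⁻¹' fluidCell n h = cell n ×ˢ Set.Iio 0 := by
    ext ⟨x, z⟩
    simp [flat, fluidCell]
  have h2 : (volume : Measure (Fin n → ℝ)).restrict (cell n) = volume.restrict (box n) :=
    Measure.restrict_congr_set Measure.univ_pi_Ico_ae_eq_Icc
  rw [h1, ← h2, Measure.prod_restrict]
  rfl

lemma fwd_bound {n : ℕ} {h : (Fin n → ℝ) → ℝ} (hh : Continuous h)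
    {v : (Fin n → ℝ) × ℝ → ℝ} (hv0 : ∀ p, 0 ≤ v p)
    (hi : IntegrableOn v (fluidCell n h)) : ∃ E, ∀ z < 0, ∫ t in z..0, sl n h v t ≤ E := by
  rw [integrableOn_flat hh] at hi
  have h1 : IntegrableOn (sl n h v) (Set.Iio 0) := hi.integral_prod_right
  refine ⟨∫ t in Set.Iio 0, sl n h v t, fun z hz => ?_⟩
  rw [intervalIntegral.integral_of_le hz.le, integral_Ioc_eq_integral_Ioo]
  exact setIntegral_mono_set h1 (Filter.Eventually.of_forall fun t => sl_nonneg hv0 t)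
    (HasSubset.Subset.eventuallyLE Set.Ioo_subset_Iio_self)

lemma bwd_bound {n : ℕ} {h : (Fin n → ℝ) → ℝ} (hh : Continuous h)
    {v : (Fin n → ℝ) × ℝ → ℝ} (hv : ContDiff ℝ sm v) (hv0 : ∀ p, 0 ≤ v p) {E : ℝ}
    (hE : ∀ z < 0, ∫ t in z..0, sl n h v t ≤ E) : IntegrableOn v (fluidCell n h) := by
  have hc := sl_cont hh hv
  have hvc := hv.continuous
  rw [integrableOn_flat hh, integrable_prod_iff' (Continuous.aestronglyMeasurable (by fun_prop))]
  constructor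
  · exact Filter.Eventually.of_forall fun z => box_int (slice_cont hh hvc z)
  · simp only [Real.norm_eq_abs, abs_of_nonneg (hv0 _)]
    have : IntegrableOn (sl n h v) (Set.Iic 0) := by
      refine integrableOn_Iic_of_intervalIntegral_norm_bounded (a := fun z : ℝ => z)
        (l := Filter.atBot) E 0 (fun z => hc.integrableOn_Ioc) Filter.tendsto_id ?_
      filter_upwards [Filter.eventually_lt_atBot 0] with z hz
      simp only [Real.norm_eq_abs, abs_of_nonneg (sl_nonneg hv0 _)]
      exact hE z hz
    exact this.mono_set Set.Iio_subset_Iic_self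

lemma closure_zero {n : ℕ} {h : (Fin n → ℝ) → ℝ} {v : (Fin n → ℝ) × ℝ → ℝ}
    (hv : Continuous v) (h0 : ∀ p : (Fin n → ℝ) × ℝ, p.2 < h p.1 → v p = 0) (x : Fin n → ℝ) :
    v (x, h x) = 0 := by
  have hc : Continuous fun y => v (x, y) := by fun_prop
  have h1 : Filter.Tendsto (fun y => v (x, y)) (nhdsWithin (h x) (Set.Iio (h x)))
      (nhds (v (x, h x))) := hc.continuousWithinAt
  refine tendsto_nhds_unique h1 (tendsto_const_nhds.congr' ?_)
  filter_upwards [self_mem_nhdsWithin] with y hy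
  exact (h0 (x, y) hy).symm

/-! ### Interior regularity: the gradient of an `L²` harmonic function is `L²` -/

lemma slice_eq {n : ℕ} {h : (Fin n → ℝ) → ℝ} {u : (Fin n → ℝ) × ℝ → ℝ}
    (hl : ∀ p : (Fin n → ℝ) × ℝ, p.2 < h p.1 → lapE n u p = 0) {z : ℝ} (hz : z < 0) :
    sl n h (fun p => gradSqE n u p + u p * lapE n u p) z = sl n h (gradSqE n u) z := by
  unfold sl
  congr 1
  ext x
  beta_reduce
  rw [hl (x, h x + z) (by simpa using hz)]
  ring

lemma cacc {n : ℕ} {h : (Fin n → ℝ) → ℝ} (hh : ContDiff ℝ sm h) (hp : ZPeriodic n h)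
    {u : (Fin n → ℝ) × ℝ → ℝ} (hu : ContDiff ℝ sm u) (hup : ZPeriodicE n u)
    (hl : ∀ p : (Fin n → ℝ) × ℝ, p.2 < h p.1 → lapE n u p = 0)
    (hL2 : IntegrableOn (fun p => (u p)^2) (fluidCell n h)) :
    IntegrableOn (gradSqE n u) (fluidCell n h) := by
  obtain ⟨C, hC, hCb⟩ := slope_bound hh
  obtain ⟨E, hE⟩ := fwd_bound hh.continuous (fun p => sq_nonneg (u p)) hL2
  have hd : ∀ z < 0, HasDerivAt (flux n h u) (sl n h (gradSqE n u) z) z := fun z hz => by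
    rw [← slice_eq hl hz]
    exact flux_deriv hh hp hu hup z
  have hpos := ode_cacc hC hd (fun z _ => sl_nonneg (gradSqE_nonneg u) z)
    (sl_cont hh.continuous (hu.pow 2)) hE (fun z _ s hs => flux_bound hh hu hCb z s hs)
  refine bwd_bound (E := flux n h u 0) hh.continuous (gradSqE_smooth hu) (gradSqE_nonneg u)
    fun z hz => ?_
  rw [intervalIntegral.integral_eq_sub_of_hasDerivAt_of_le hz.le
    (fun t _ => (flux_deriv hh hp hu hup t).continuousAt.continuousWithinAt)
    (fun t ht => hd t ht.2)
    ((sl_cont hh.continuous (gradSqE_smooth hu)).intervalIntegrable _ _)]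
  linarith [hpos z hz]

/-! ### Uniqueness -/

lemma uniq_zero {n : ℕ} {h : (Fin n → ℝ) → ℝ} (hh : ContDiff ℝ sm h) (hp : ZPeriodic n h)
    {w : (Fin n → ℝ) × ℝ → ℝ} (H : IsHarmonicExt n h 0 w) (x : Fin n → ℝ) :
    gradSqE n w (x, h x) = 0 := by
  have hw := H.smooth
  obtain ⟨C, hC, hCb⟩ := slope_bound hh
  obtain ⟨E, hE⟩ := fwd_bound hh.continuous (gradSqE_nonneg w) H.gradL2
  have hd : ∀ z < 0, HasDerivAt (flux n h w) (sl n h (gradSqE n w) z) z := fun z hz => by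
    rw [← slice_eq H.harmonic hz]
    exact flux_deriv hh hp hw H.periodic z
  have hb : ∀ x, w (x, h x) = 0 := fun x => by simpa using H.boundary x
  have hJ0 : flux n h w 0 = 0 := by simp [flux, hb]
  have c0 := hh.continuous
  have iw := fun z => box_int (slice_cont c0 (hw.pow 2).continuous z)
  have ig := fun z => box_int (slice_cont c0 (gradSqE_smooth hw).continuous z)
  have hz := ode_uniq (J := flux n h w) (g := sl n h (gradSqE n w))
    (f := sl n h (fun p => (w p)^2)) (F := sl n h (pdE n (fun p => (w p)^2) (eY n)))
    (E := E) hC hd (fun z _ => sl_nonneg (gradSqE_nonneg w) z)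
    (flux_deriv hh hp hw H.periodic 0).continuousAt hJ0
    (fun z hz => by
      refine le_trans (le_of_eq ?_) (hE z hz)
      rw [intervalIntegral.integral_eq_sub_of_hasDerivAt_of_le hz.le
        (fun t _ => (flux_deriv hh hp hw H.periodic t).continuousAt.continuousWithinAt)
        (fun t ht => hd t ht.2)
        ((sl_cont c0 (gradSqE_smooth hw)).intervalIntegrable _ _)]
      simp [hJ0])
    (sl_deriv c0 (hw.pow 2)) (by simp [sl, hb])
    (by
      simp only [sq, pdE_mul hw hw, sl, add_zero, hb]
      simp)
    (fun z _ s hs => by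
      have e : s * sl n h (fun p => (w p)^2) z + sl n h (gradSqE n w) z / s =
          ∫ x in box n, (s * (w (x, h x + z))^2 + (1 / s) * gradSqE n w (x, h x + z)) := by
        rw [integral_add ((iw z).const_mul _) ((ig z).const_mul _), integral_const_mul,
          integral_const_mul]
        unfold sl
        ring
      rw [e, sl, ← integral_neg]
      refine integral_mono
        (box_int (slice_cont c0 (pdE_smooth (hw.pow 2) (eY n)).continuous z)).neg
        (((iw z).const_mul _).add ((ig z).const_mul _)) (fun x => ?_)
      simp only [sq, pdE_mul hw hw]
      set p := (x, h x + z)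
      have h1 : (pdE n w (eY n) p)^2 ≤ gradSqE n w p := by
        unfold gradSqE
        have : 0 ≤ ∑ i, (pdE n w (eX n i) p)^2 := by positivity
        linarith
      have h2 : (1/s) * (pdE n w (eY n) p)^2 ≤ (1/s) * gradSqE n w p := by gcongr
      have h3 : s * (w p * w p) + (1/s) * (pdE n w (eY n) p)^2
          + 2 * (w p * pdE n w (eY n) p) = (1/s) * (s * w p + pdE n w (eY n) p)^2 := by
        field_simp
        ring
      have h4 : 0 ≤ (1/s) * (s * w p + pdE n w (eY n) p)^2 := by positivity
      linarith)
    (fun z _ s hs => flux_bound hh hw hCb z s hs)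
  have hg0 : ∀ z < 0, sl n h (gradSqE n w) z = 0 := by
    intro z hz'
    refine (hd z hz').unique ((hasDerivAt_const z (0:ℝ)).congr_of_eventuallyEq ?_)
    filter_upwards [Iio_mem_nhds hz'] with t ht
    exact hz t ht
  have hbox : ∀ z < 0, ∀ x ∈ box n, gradSqE n w (x, h x + z) = 0 := by
    intro z hz' 
    have hc := slice_cont c0 (gradSqE_smooth hw).continuous z
    have h1 := (integral_eq_zero_iff_of_nonneg
      (Pi.le_def.2 fun x => gradSqE_nonneg w (x, h x + z)) (ig z)).1 (hg0 z hz')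
    refine Measure.eqOn_of_ae_eq (s := box n) h1 hc.continuousOn continuousOn_const ?_
    have e : box n = Set.univ.pi fun _ => Set.Icc (0:ℝ) 1 := (Set.pi_univ_Icc _ _).symm
    rw [e, interior_pi_set Set.finite_univ, closure_pi_set]
    simp
  have hall : ∀ p : (Fin n → ℝ) × ℝ, p.2 < h p.1 → gradSqE n w p = 0 := by
    rintro ⟨x, y⟩ hy
    have hy : y < h x := hy
    set x0 : Fin n → ℝ := fun i => Int.fract (x i)
    have ex : x = x0 + fun i => ((⌊x i⌋ : ℤ) : ℝ) := by
      ext i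
      simp [x0]
    have hhx : h x = h x0 := by
      rw [ex]; exact hp x0 _
    have hper : gradSqE n w (x, y) = gradSqE n w (x0, y) := by
      rw [ex]
      simp only [gradSqE, pdE_periodic H.periodic _ x0 y (fun i => ⌊x i⌋)]
    rw [hper]
    have := hbox (y - h x0) (by linarith) x0
      ⟨fun i => Int.fract_nonneg _, fun i => (Int.fract_lt_one _).le⟩
    simpa using this
  exact closure_zero (gradSqE_smooth hw).continuous hall x

lemma gradSqE_zero {n : ℕ} {w : (Fin n → ℝ) × ℝ → ℝ} {p} (h : gradSqE n w p = 0) :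
    (∀ i, pdE n w (eX n i) p = 0) ∧ pdE n w (eY n) p = 0 := by
  unfold gradSqE at h
  have h1 : 0 ≤ ∑ i, (pdE n w (eX n i) p)^2 := by positivity
  have h2 := sq_nonneg (pdE n w (eY n) p)
  have h3 : ∑ i, (pdE n w (eX n i) p)^2 = 0 := by linarith
  refine ⟨fun i => ?_, by nlinarith⟩
  have := (Finset.sum_eq_zero_iff_of_nonneg (fun i _ => sq_nonneg _)).1 h3 i (Finset.mem_univ i)
  simpa using this

lemma pdE_sub {n : ℕ} {f g : (Fin n → ℝ) × ℝ → ℝ} (hf : ContDiff ℝ sm f) (hg : ContDiff ℝ sm g)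
    (v : (Fin n → ℝ) × ℝ) :
    pdE n (fun q => f q - g q) v = fun p => pdE n f v p - pdE n g v p := by
  ext p
  unfold pdE
  rw [fderiv_fun_sub (hf.differentiable sm_ne_zero p) (hg.differentiable sm_ne_zero p)]
  simp

lemma uniq {n : ℕ} {h ψ : (Fin n → ℝ) → ℝ} (hh : ContDiff ℝ sm h) (hp : ZPeriodic n h)
    {φ₁ φ₂ : (Fin n → ℝ) × ℝ → ℝ} (H₁ : IsHarmonicExt n h ψ φ₁) (H₂ : IsHarmonicExt n h ψ φ₂)
    (x : Fin n → ℝ) : (∀ i, pdE n φ₁ (eX n i) (x, h x) = pdE n φ₂ (eX n i) (x, h x)) ∧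
      pdE n φ₁ (eY n) (x, h x) = pdE n φ₂ (eY n) (x, h x) := by
  have s1 := H₁.smooth
  have s2 := H₂.smooth
  have H : IsHarmonicExt n h 0 (fun q => φ₁ q - φ₂ q) := by
    refine ⟨s1.sub s2, ?_, ?_, ?_, ?_⟩
    · intro x y k
      simp only [H₁.periodic x y k, H₂.periodic x y k]
    · intro p hp
      have e1 := H₁.harmonic p hp
      have e2 := H₂.harmonic p hp
      unfold lapE at *
      simp only [pdE_sub s1 s2, pdE_sub (pdE_smooth s1 _) (pdE_smooth s2 _),
        Finset.sum_sub_distrib]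
      linarith
    · intro x
      simp [H₁.boundary x, H₂.boundary x]
    · refine ((H₁.gradL2.const_mul 2).add (H₂.gradL2.const_mul 2)).mono'
        (gradSqE_smooth (s1.sub s2)).continuous.aestronglyMeasurable
        (Filter.Eventually.of_forall fun p => ?_)
      rw [Real.norm_eq_abs, abs_of_nonneg (gradSqE_nonneg _ _)]
      have key : ∀ a b : ℝ, (a - b)^2 ≤ 2 * a^2 + 2 * b^2 := fun a b => by
        nlinarith [sq_nonneg (a + b)]
      simp only [gradSqE, pdE_sub s1 s2, Pi.add_apply]
      have h1 : ∑ i, (pdE n φ₁ (eX n i) p - pdE n φ₂ (eX n i) p)^2 ≤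
          2 * ∑ i, (pdE n φ₁ (eX n i) p)^2 + 2 * ∑ i, (pdE n φ₂ (eX n i) p)^2 := by
        rw [Finset.mul_sum, Finset.mul_sum, ← Finset.sum_add_distrib]
        exact Finset.sum_le_sum fun i _ => key _ _
      have h2 := key (pdE n φ₁ (eY n) p) (pdE n φ₂ (eY n) p)
      linarith
  obtain ⟨hx, hy⟩ := gradSqE_zero (uniq_zero hh hp H x)
  simp only [pdE_sub s1 s2] at hx hy
  exact ⟨fun i => sub_eq_zero.1 (hx i), sub_eq_zero.1 hy⟩

lemma DtN_eq {n : ℕ} {h ψ : (Fin n → ℝ) → ℝ} (hh : ContDiff ℝ sm h) (hp : ZPeriodic n h)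
    {φ : (Fin n → ℝ) × ℝ → ℝ} (H : IsHarmonicExt n h ψ φ) (x : Fin n → ℝ) :
    DtN n h ψ x = pdE n φ (eY n) (x, h x) - ∑ i, pdX n h i x * pdE n φ (eX n i) (x, h x) := by
  have hex : ∃ φ, IsHarmonicExt n h ψ φ := ⟨φ, H⟩
  obtain ⟨hX, hY⟩ := uniq hh hp hex.choose_spec H x
  unfold DtN
  rw [dif_pos hex]
  simp only [hX, hY]

lemma ext_pdY {n : ℕ} {h ψ : (Fin n → ℝ) → ℝ} (hh : ContDiff ℝ sm h) (hp : ZPeriodic n h)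
    {φ : (Fin n → ℝ) × ℝ → ℝ} (H : IsHarmonicExt n h ψ φ) :
    IsHarmonicExt n h (fun x => pdE n φ (eY n) (x, h x)) (pdE n φ (eY n)) := by
  have s := H.smooth
  have sY := pdE_smooth s (eY n)
  have hper := pdE_periodic H.periodic (eY n)
  have hlap : ∀ p : (Fin n → ℝ) × ℝ, p.2 < h p.1 → lapE n (pdE n φ (eY n)) p = 0 := by
    have e : ∀ p, lapE n (pdE n φ (eY n)) p = pdE n (lapE n φ) (eY n) p := by
      intro p
      have c : ∀ v, pdE n (pdE n (pdE n φ (eY n)) v) v p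
          = pdE n (pdE n (pdE n φ v) v) (eY n) p := by
        intro v
        have : pdE n (pdE n φ (eY n)) v = pdE n (pdE n φ v) (eY n) :=
          funext fun q => pdE_comm s _ _ q
        rw [this, pdE_comm (pdE_smooth s v)]
      have d := fun v => (pdE_smooth (pdE_smooth s v) v).differentiable sm_ne_zero p
      have e2 : pdE n (lapE n φ) (eY n) p = (∑ i, pdE n (pdE n (pdE n φ (eX n i)) (eX n i))
          (eY n) p) + pdE n (pdE n (pdE n φ (eY n)) (eY n)) (eY n) p := by
        have f1 : HasFDerivAt (lapE n φ) _ p :=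
          (HasFDerivAt.fun_sum (u := Finset.univ)
            fun i _ => (d (eX n i)).hasFDerivAt).fun_add (d (eY n)).hasFDerivAt
        conv_lhs => unfold pdE
        rw [f1.fderiv]
        simp [pdE]
      rw [e2]
      unfold lapE
      simp only [c]
    intro p hp
    rw [e]
    have ho : IsOpen {p : (Fin n → ℝ) × ℝ | p.2 < h p.1} :=
      isOpen_lt continuous_snd (hh.continuous.comp continuous_fst)
    have : lapE n φ =ᶠ[nhds p] fun _ => 0 := by
      filter_upwards [ho.mem_nhds hp] with q hq
      exact H.harmonic q hq
    unfold pdE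
    rw [this.fderiv_eq]
    simp
  refine ⟨sY, hper, hlap, fun x => rfl, ?_⟩
  refine cacc hh hp sY hper hlap ?_
  refine H.gradL2.mono' (sY.pow 2).continuous.aestronglyMeasurable
    (Filter.Eventually.of_forall fun p => ?_)
  rw [Real.norm_eq_abs, abs_of_nonneg (sq_nonneg _)]
  unfold gradSqE
  have : 0 ≤ ∑ i, (pdE n φ (eX n i) p)^2 := by positivity
  linarith

lemma ext_zero (n : ℕ) (h : (Fin n → ℝ) → ℝ) : IsHarmonicExt n h 0 (fun _ => 0) := by
  have e : ∀ v, pdE n (fun _ => (0:ℝ)) v = fun _ => 0 := by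
    intro v; ext p; simp [pdE]
  refine ⟨contDiff_const, fun _ _ _ => rfl, fun p _ => ?_, fun _ => rfl, ?_⟩
  · simp [lapE, e]
  · have : gradSqE n (fun _ => (0:ℝ)) = fun _ => 0 := by
      ext p; simp [gradSqE, e]
    rw [this]
    exact integrableOn_zero

/-- G(h)(B(h)ψ) = −div(V(h)ψ). -/
theorem DtN_Bop_div_Vop (n : ℕ) (hn : 1 ≤ n) (h ψ : (Fin n → ℝ) → ℝ)
    (hh : ContDiff ℝ (⊤ : ℕ∞) h) (hhper : ZPeriodic n h)
    (hψ : ContDiff ℝ (⊤ : ℕ∞) ψ) (hψper : ZPeriodic n ψ) :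
    ∀ x, DtN n h (Bop n h ψ) x = - divX n (Vop n h ψ) x := by
  intro x
  by_cases H : ∃ φ, IsHarmonicExt n h ψ φ
  · have hB : Bop n h ψ = fun x => pdE n H.choose (eY n) (x, h x) := by
      unfold Bop; rw [dif_pos H]
    have hV : Vop n h ψ = fun x i => pdE n H.choose (eX n i) (x, h x) := by
      unfold Vop; rw [dif_pos H]
    have Hs := H.choose_spec
    rw [hB, hV, DtN_eq hh hhper (ext_pdY hh hhper Hs)]
    set φ := H.choose
    have s := Hs.smooth
    have hl : lapE n φ (x, h x) = 0 :=
      closure_zero (lapE_smooth s).continuous Hs.harmonic x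
    unfold lapE at hl
    have hX : ∀ i, pdX n (fun z => pdE n φ (eX n i) (z, h z)) i x =
        pdE n (pdE n φ (eX n i)) (eX n i) (x, h x)
          + pdX n h i x * pdE n (pdE n φ (eX n i)) (eY n) (x, h x) := by
      intro i
      have := pdX_slice hh (pdE_smooth s (eX n i)) 0 i x
      simpa only [add_zero] using this
    simp only [divX, hX, Finset.sum_add_distrib, pdE_comm s (eX n _) (eY n)]
    linarith
  · have hB : Bop n h ψ = 0 := by
      unfold Bop; rw [dif_neg H]
    have hV : Vop n h ψ = 0 := by
      unfold Vop; rw [dif_neg H]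
    rw [hB, hV, DtN_eq hh hhper (ext_zero n h)]
    simp [divX, pdX, pdE]

end
end
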